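/- arXiv:1307.5484 — 2 statements merged into one kernel-verified Lean document; each statement's English description precedes it below -/
import Mathlib

section
/- (Limit Theorem for geometric constructibility.) Let a₁, …, aₘ and d be real numbers with d ∈ Qclo(ℚ(a₁,…,aₘ)), and let u be a real-valued function. Suppose there exist ε > 0 and a nonzero polynomial W in two variables over ℝ such that: (i) u is defined on the interval (d, d+ε); (ii) every coefficient of W belongs to Qclo(ℚ(a₁,…,aₘ)), and W(c, u(c)) = 0 for every c ∈ (d, d+ε) that is transcendental over ℚ(a₁,…,aₘ); (iii) for every c ∈ (d, d+ε) transcendental over ℚ(a₁,…,aₘ), u(c) ∈ Qclo(ℚ(a₁,…,aₘ,c)); and (iv) the one-sided limit L = lim_{x→d⁺} u(x) exists in ℝ. Then L ∈ Qclo(ℚ(a₁,…,aₘ)). -/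
open Filter

/-- The real quadratic closure of a subfield `K` of `ℝ`: the smallest subfield of `ℝ`
containing `K` that is closed under real square roots. -/
noncomputable def Qclo (K : Subfield ℝ) : Subfield ℝ :=
  sInf {M : Subfield ℝ | K ≤ M ∧ ∀ c : ℝ, c ∈ M → 0 ≤ c → Real.sqrt c ∈ M}

/-- `c` is transcendental over the subfield `K` of `ℝ`: it is a root of no nonzero
polynomial with coefficients in `K`. -/
def TranscOver (K : Subfield ℝ) (c : ℝ) : Prop :=
  ∀ p : Polynomial ℝ, (∀ i, p.coeff i ∈ K) → Polynomial.eval c p = 0 → p = 0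

open Polynomial

theorem le_Qclo (K : Subfield ℝ) : K ≤ Qclo K := le_sInf fun _ hM => hM.1

theorem sqrt_mem_Qclo {K : Subfield ℝ} {c : ℝ} (hc : c ∈ Qclo K) : √c ∈ Qclo K := by
  rcases le_total 0 c with h | h
  · rw [Qclo, Subfield.mem_sInf] at hc ⊢
    exact fun M hM => hM.2 c (hc M hM) h
  · rw [Real.sqrt_eq_zero_of_nonpos h]
    exact zero_mem _

theorem Qclo_le {K M : Subfield ℝ} (hK : K ≤ M) (hM : ∀ c ∈ M, 0 ≤ c → √c ∈ M) : Qclo K ≤ M :=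
  sInf_le ⟨hK, hM⟩

theorem Qclo_mono {K M : Subfield ℝ} (h : K ≤ M) : Qclo K ≤ Qclo M :=
  Qclo_le (h.trans (le_Qclo M)) fun _ hc _ => sqrt_mem_Qclo hc

theorem isAlgebraic_of_mem_Qclo {K : Subfield ℝ} {x : ℝ} (hx : x ∈ Qclo K) : IsAlgebraic K x := by
  have hle : Qclo K ≤ (algebraicClosure K ℝ).toSubfield := by
    refine Qclo_le (fun y hy => ?_) fun c hc h0 => ?_
    · exact mem_algebraicClosure_iff.2 (isAlgebraic_algebraMap (⟨y, hy⟩ : K))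
    · refine mem_algebraicClosure_iff.2 (IsAlgebraic.of_pow two_pos ?_)
      rw [Real.sq_sqrt h0]
      exact mem_algebraicClosure_iff.1 hc
  exact mem_algebraicClosure_iff.1 (hle hx)

theorem transcOver_iff {K : Subfield ℝ} {c : ℝ} : TranscOver K c ↔ Transcendental K c := by
  rw [transcendental_iff]
  constructor
  · intro h p hp
    have := h (p.map K.subtype) (fun i => by simp [coeff_map]) (by
      rw [eval_map]; exact hp)
    exact (Polynomial.map_eq_zero _).1 this
  · intro h p hp hc
    obtain ⟨q, rfl⟩ : p ∈ (mapRingHom K.subtype).rangeS :=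
      (mem_map_rangeS _).2 fun n => ⟨⟨_, hp n⟩, rfl⟩
    rw [coe_mapRingHom, eval_map] at hc
    rw [h q hc]
    simp

theorem TranscOver.transcendental_Qclo {K : Subfield ℝ} {c : ℝ} (hc : TranscOver K c) :
    Transcendental (Qclo K) c := by
  let _ : Algebra K (Qclo K) := (Subfield.inclusion (le_Qclo K)).toAlgebra
  have : IsScalarTower K (Qclo K) ℝ := IsScalarTower.of_algebraMap_eq fun _ => rfl
  have : Algebra.IsAlgebraic K (Qclo K) := ⟨fun x =>
    (isAlgebraic_algebraMap_iff (algebraMap (Qclo K) ℝ).injective).1 (isAlgebraic_of_mem_Qclo x.2)⟩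
  exact fun h => transcOver_iff.1 hc (h.restrictScalars K)

/-- The complex numbers whose real and imaginary parts lie in a subfield of `ℝ`. -/
def complexSubfield (K : Subfield ℝ) : Subfield ℂ where
  carrier := {z | z.re ∈ K ∧ z.im ∈ K}
  one_mem' := by simp [one_mem, zero_mem]
  zero_mem' := by simp [zero_mem]
  mul_mem' := fun ⟨h1, h2⟩ ⟨h3, h4⟩ => ⟨sub_mem (mul_mem h1 h3) (mul_mem h2 h4),
    add_mem (mul_mem h1 h4) (mul_mem h2 h3)⟩
  add_mem' := fun ⟨h1, h2⟩ ⟨h3, h4⟩ => ⟨add_mem h1 h3, add_mem h2 h4⟩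
  neg_mem' := fun ⟨h1, h2⟩ => ⟨neg_mem h1, neg_mem h2⟩
  inv_mem' := fun z ⟨h1, h2⟩ => by
    have hn : Complex.normSq z ∈ K := by
      rw [Complex.normSq_apply]
      exact add_mem (mul_mem h1 h1) (mul_mem h2 h2)
    exact ⟨by rw [Complex.inv_re]; exact div_mem h1 hn,
      by rw [Complex.inv_im]; exact div_mem (neg_mem h2) hn⟩

theorem isSquare_complexSubfield {K : Subfield ℝ} (hK : ∀ c ∈ K, √c ∈ K)
    (z : complexSubfield K) : IsSquare z := by
  obtain ⟨z, h1, h2⟩ := z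
  have hn : ‖z‖ ∈ K := by
    rw [Complex.norm_eq_sqrt_sq_add_sq]
    exact hK _ (add_mem (pow_mem h1 2) (pow_mem h2 2))
  have h2K : (2 : ℝ) ∈ K := ofNat_mem K 2
  have hre := Complex.abs_re_le_norm z
  rw [abs_le] at hre
  set p := √((‖z‖ + z.re) / 2) with hp
  set q := √((‖z‖ - z.re) / 2) with hq
  have hpK : p ∈ K := hK _ (div_mem (add_mem hn h1) h2K)
  have hqK : q ∈ K := hK _ (div_mem (sub_mem hn h1) h2K)
  have hpp : p * p = (‖z‖ + z.re) / 2 := Real.mul_self_sqrt (by linarith)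
  have hqq : q * q = (‖z‖ - z.re) / 2 := Real.mul_self_sqrt (by linarith)
  have hpq : p * q = |z.im| / 2 := by
    rw [hp, hq, ← Real.sqrt_mul (by linarith), ← Real.sqrt_sq (by positivity : 0 ≤ |z.im| / 2)]
    congr 1
    have := Complex.sq_norm z
    rw [Complex.normSq_apply] at this
    rw [div_pow, sq_abs]
    nlinarith
  rcases le_total 0 z.im with h | h
  · rw [abs_of_nonneg h] at hpq
    refine ⟨⟨⟨p, q⟩, hpK, hqK⟩, Subtype.ext (Complex.ext ?_ ?_)⟩
    · change z.re = p * p - q * q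
      linarith
    · change z.im = p * q + q * p
      linarith
  · rw [abs_of_nonpos h] at hpq
    refine ⟨⟨⟨p, -q⟩, hpK, neg_mem hqK⟩, Subtype.ext (Complex.ext ?_ ?_)⟩
    · change z.re = p * p - (-q) * (-q)
      linarith
    · change z.im = p * (-q) + (-q) * p
      linarith

theorem frequently_transcOver {K : Subfield ℝ} (hK : Countable K) (d : ℝ) :
    ∃ᶠ c in nhdsWithin d (Set.Ioi d), TranscOver K c := by
  have hcount : {x : ℝ | IsAlgebraic K x}.Countable := Algebraic.countable K ℝ
  have hdense := hcount.dense_compl ℝ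
  intro hev
  obtain ⟨b, hb, hsub⟩ := mem_nhdsGT_iff_exists_Ioo_subset.1 hev
  obtain ⟨c, hc, hcd⟩ := hdense.exists_mem_open isOpen_Ioo (Set.nonempty_Ioo.2 hb)
  exact hsub hcd (transcOver_iff.2 hc)

theorem countable_closure_range {m : ℕ} (a : Fin m → ℝ) :
    Countable (Subfield.closure (Set.range a)) := by
  rw [← Cardinal.mk_le_aleph0_iff]
  exact (Subfield.cardinalMk_closure_le_max _).trans (by simp)

section Splitting

variable {F E H : Type*} [Field F] [Field E] [Field H] [Algebra F E] [Algebra F H]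

/-- Elements over `F` whose minimal polynomial splits over a field `H` with all square roots
form a subfield closed under square roots. -/
theorem exists_subfield_splits (hH : ∀ h : H, IsSquare h) :
    ∃ M : IntermediateField F E, (∀ x : E, x ^ 2 ∈ M → x ∈ M) ∧
      ∀ x ∈ M, IsIntegral F x ∧ ((minpoly F x).map (algebraMap F H)).Splits := by
  let S : Set E := {x | IsIntegral F x ∧ ((minpoly F x).map (algebraMap F H)).Splits}
  have hmem : ∀ x ∈ IntermediateField.adjoin F S, x ∈ S := fun x hx =>
    ⟨(IntermediateField.isAlgebraic_adjoin (S := S) fun y hy => hy.1).isIntegral.1 ⟨x, hx⟩ |>.map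
      (IntermediateField.val _), IntermediateField.splits_of_mem_adjoin F E (fun y hy => hy) hx⟩
  refine ⟨IntermediateField.adjoin F S, fun x hx => ?_, hmem⟩
  obtain ⟨hint, hsplit⟩ := hmem _ hx
  have hxint : IsIntegral F x := hint.of_pow two_pos
  refine IntermediateField.subset_adjoin F S ⟨hxint, ?_⟩
  set p := minpoly F (x ^ 2)
  have hp0 : p.comp (X ^ 2) ≠ 0 := by
    rw [← expand_eq_comp_X_pow, Ne, expand_eq_zero two_pos]
    exact minpoly.ne_zero hint
  have hdvd : minpoly F x ∣ p.comp (X ^ 2) := minpoly.dvd F x (by simp [aeval_comp, p])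
  refine Splits.of_dvd ?_ (Polynomial.map_ne_zero hp0) (Polynomial.map_dvd _ hdvd)
  rw [Polynomial.map_comp, hsplit.eq_prod_roots, mul_comp, multiset_prod_comp]
  refine Splits.mul (by simp) (Splits.multisetProd fun g hg => ?_)
  simp only [Multiset.map_map, Multiset.mem_map] at hg
  obtain ⟨r, -, rfl⟩ := hg
  obtain ⟨s, rfl⟩ := hH r
  have : (X - C s) * (X + C s) = (X ^ 2 - C (s * s) : H[X]) := by
    rw [C_mul]; ring
  simp only [Function.comp, sub_comp, X_comp, C_comp, Polynomial.map_pow, map_X]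
  rw [← this]
  exact (Splits.X_sub_C s).mul (Splits.X_add_C s)

/-- A polynomial over `F` has a largest divisor splitting over `H`. -/
theorem exists_split_factor {W : F[X]} (hW : W ≠ 0) :
    ∃ P : F[X], P ≠ 0 ∧ (P.map (algebraMap F H)).Splits ∧
      ∀ q, Irreducible q → (q.map (algebraMap F H)).Splits → q ∣ W → q ∣ P := by
  classical
  let s := (UniqueFactorizationMonoid.normalizedFactors W).filter
    fun q => (q.map (algebraMap F H)).Splits
  refine ⟨s.prod, ?_, ?_, fun q hq hqs hqW => ?_⟩
  · refine Multiset.prod_ne_zero fun h0 => ?_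
    exact UniqueFactorizationMonoid.zero_notMem_normalizedFactors W (Multiset.mem_of_mem_filter h0)
  · rw [Polynomial.map_multiset_prod]
    refine Splits.multisetProd fun g hg => ?_
    obtain ⟨q, hq, rfl⟩ := Multiset.mem_map.1 hg
    exact (Multiset.mem_filter.1 hq).2
  · obtain ⟨r, hr, hqr⟩ := UniqueFactorizationMonoid.exists_mem_normalizedFactors_of_dvd hW hq hqW
    refine hqr.dvd.trans (Multiset.dvd_prod (Multiset.mem_filter.2 ⟨hr, ?_⟩))
    refine hqs.of_dvd (Polynomial.map_ne_zero hq.ne_zero) (Polynomial.map_dvd _ hqr.symm.dvd)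
end Splitting

/-- A field in which every element of `R` is a square stays so after passing to Hahn series. -/
theorem HahnSeries.isSquare_of_forall_isSquare {R : Type*} [Field R] [CharZero R]
    (hR : ∀ r : R, IsSquare r) (x : HahnSeries ℚ R) : IsSquare x := by
  rcases eq_or_ne x 0 with rfl | hx
  · exact IsSquare.zero
  have hlc : x.leadingCoeff ≠ 0 := leadingCoeff_ne_zero.2 hx
  have hs : single (-x.order) x.leadingCoeff⁻¹ ≠ 0 := by simpa using hx
  set y := single (-x.order) x.leadingCoeff⁻¹ * x with hy
  have hy0 : y ≠ 0 := mul_ne_zero hs hx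
  have hpos : 0 < (y - 1).orderTop := by
    rw [orderTop_self_sub_one_pos_iff]
    constructor
    · rw [← order_eq_orderTop_of_ne_zero hy0, hy, order_mul hs hx, order_single (by simpa using hx)]
      simp
    · rw [hy, leadingCoeff_mul, leadingCoeff_of_single, inv_mul_cancel₀ hlc]
  have hy_sq : IsSquare y := by
    let Y : orderTopSubOnePos ℚ R := toOrderTopSubOnePos hpos
    refine ⟨((Y ^ (1 / 2 : R) : orderTopSubOnePos ℚ R) : (HahnSeries ℚ R)ˣ), ?_⟩
    have h1 : Y ^ (1 / 2 : R) * Y ^ (1 / 2 : R) = Y ^ (1 : R) := by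
      rw [← HahnSeries.pow_add]; norm_num
    have h2 : (((Y ^ (1 : R) : orderTopSubOnePos ℚ R) : (HahnSeries ℚ R)ˣ) : HahnSeries ℚ R) = y := by
      have h3 : PowerSeries.binomialSeries R (1 : R) = 1 + PowerSeries.X := by
        simpa using PowerSeries.binomialSeries_nat (R := R) (A := R) 1
      change PowerSeries.heval (y - 1) (PowerSeries.binomialSeries R (1 : R)) = y
      rw [h3, map_add, map_one, PowerSeries.heval_X _ hpos, add_sub_cancel]
    rw [← h2, ← h1]
    simp
  obtain ⟨r, hr⟩ := hR x.leadingCoeff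
  have hx_eq : x = single x.order x.leadingCoeff * y := by
    rw [hy, ← mul_assoc, single_mul_single]
    simp [hlc]
  have hsing : IsSquare (single x.order x.leadingCoeff) :=
    ⟨single (x.order / 2) r, by rw [single_mul_single, ← hr, add_halves]⟩
  rw [hx_eq]
  exact hsing.mul hy_sq

/-- Applying a ring homomorphism to the coefficients of a Hahn series. -/
noncomputable def HahnSeries.mapCoeffHom {R S : Type*} [CommRing R] [CommRing S] (f : R →+* S) :
    HahnSeries ℚ R →+* HahnSeries ℚ S where
  toFun x := x.map f
  map_one' := HahnSeries.map_one f.toMonoidWithZeroHom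
  map_zero' := HahnSeries.map_zero f.toAddMonoidHom.toZeroHom
  map_mul' _ _ := HahnSeries.map_mul f.toNonUnitalRingHom
  map_add' _ _ := HahnSeries.map_add f.toAddMonoidHom

@[simp]
theorem HahnSeries.coeff_mapCoeffHom {R S : Type*} [CommRing R] [CommRing S] (f : R →+* S)
    (x : HahnSeries ℚ R) (q : ℚ) : (mapCoeffHom f x).coeff q = f (x.coeff q) := rfl

@[simp]
theorem HahnSeries.mapCoeffHom_single {R S : Type*} [CommRing R] [CommRing S] (f : R →+* S)
    (q : ℚ) (r : R) : mapCoeffHom f (single q r) = single q (f r) :=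
  HahnSeries.map_single f.toAddMonoidHom.toZeroHom

/-- The expansion at the point `d` of polynomials as Hahn series in a local parameter. -/
noncomputable def expandAt {K R : Type*} [Field K] [Field R] (i : K →+* R) (d : K) :
    K[X] →+* HahnSeries ℚ R :=
  eval₂RingHom (HahnSeries.C.comp i) (HahnSeries.C (i d) + HahnSeries.single 1 1)

theorem mapCoeffHom_comp_expandAt {K R S : Type*} [Field K] [Field R] [Field S] (i : K →+* R)
    (f : R →+* S) (d : K) :
    (HahnSeries.mapCoeffHom f).comp (expandAt i d) = expandAt (f.comp i) d := by
  refine ringHom_ext (fun r => ?_) ?_ <;> simp [expandAt, HahnSeries.C_apply]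

theorem expandAt_injective {K R : Type*} [Field K] [Field R] (i : K →+* R) (d : K) :
    Function.Injective (expandAt i d) := by
  rw [injective_iff_map_eq_zero]
  intro p hp
  have key : expandAt i d p =
      HahnSeries.ofPowerSeries ℚ R (((taylor d p).map i : R[X]) : PowerSeries R) := by
    change _ = (((HahnSeries.ofPowerSeries ℚ R).comp (coeToPowerSeries.ringHom)).comp
      ((mapRingHom i).comp (taylorAlgHom d : K[X] →+* K[X]))) p
    congr 1
    ext <;> simp [expandAt, add_comm]
  rw [key] at hp
  have h := HahnSeries.ofPowerSeries_injective (hp.trans (map_zero _).symm)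
  rw [Polynomial.coe_eq_zero_iff, Polynomial.map_eq_zero] at h
  exact taylor_injective d (h.trans (map_zero _).symm)

theorem exists_eval₂_expandAt {K R : Type*} [Field K] [Field R] (i : K →+* R) (d : K)
    (P : K[X][X]) (e : R) :
    ∃ s : PowerSeries R, eval₂ (expandAt i d) (HahnSeries.C e) P = HahnSeries.ofPowerSeries ℚ R s ∧
      PowerSeries.constantCoeff s = eval₂ (i.comp (evalRingHom d)) e P := by
  let Ψ : K[X] →+* PowerSeries R :=
    eval₂RingHom (PowerSeries.C.comp i) (PowerSeries.C (i d) + PowerSeries.X)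
  refine ⟨eval₂ Ψ (PowerSeries.C e) P, ?_, ?_⟩
  · rw [hom_eval₂, HahnSeries.ofPowerSeries_C]
    congr 1
    ext <;> simp [Ψ, expandAt]
  · rw [hom_eval₂]
    congr 1
    ext <;> simp [Ψ]

theorem HahnSeries.addVal_ofPowerSeries_nonneg {R : Type*} [Field R] (s : PowerSeries R) :
    0 ≤ addVal ℚ R (ofPowerSeries ℚ R s) := by
  rw [addVal_apply, ofPowerSeries_apply, orderTop_embDomain]
  cases (toPowerSeries.symm s).orderTop with
  | top => simp
  | coe n => exact WithTop.coe_le_coe.2 (Nat.cast_nonneg n)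

theorem HahnSeries.addVal_ofPowerSeries_pos {R : Type*} [Field R] {s : PowerSeries R}
    (hs : PowerSeries.constantCoeff s = 0) : 0 < addVal ℚ R (ofPowerSeries ℚ R s) := by
  obtain ⟨g, rfl⟩ := PowerSeries.X_dvd_iff.2 hs
  rw [map_mul, AddValuation.map_mul, ofPowerSeries_X, addVal_apply, orderTop_single one_ne_zero]
  exact add_pos_of_pos_of_nonneg (by simp) (addVal_ofPowerSeries_nonneg g)

theorem HahnSeries.addVal_ofPowerSeries_le_zero {R : Type*} [Field R] {s : PowerSeries R}
    (hs : PowerSeries.constantCoeff s ≠ 0) : addVal ℚ R (ofPowerSeries ℚ R s) ≤ 0 := by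
  refine addVal_le_of_coeff_ne_zero (g := 0) ?_
  simpa using (ofPowerSeries_apply_coeff (Γ := ℚ) s 0).trans_ne (by simpa using hs)

theorem AddValuation.multiset_prod_map_le {R Γ ι : Type*} [CommRing R]
    [LinearOrderedAddCommMonoidWithTop Γ] (v : AddValuation R Γ)
    (s : Multiset ι) (f g : ι → R) (h : ∀ b ∈ s, v (f b) ≤ v (g b)) :
    v (s.map f).prod ≤ v (s.map g).prod := by
  induction s using Multiset.induction with
  | empty => simp
  | cons a s ih =>
    simp only [Multiset.map_cons, Multiset.prod_cons, AddValuation.map_mul]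
    exact add_le_add (h a (by simp)) (ih fun b hb => h b (by simp [hb]))

theorem HahnSeries.addVal_C_sub_le {R S : Type*} [Field R] [Field S] (f : R →+* S) {e : S}
    (he : e ∉ f.range) (z : R) (b : HahnSeries ℚ R) :
    addVal ℚ S (C e - mapCoeffHom f b) ≤ addVal ℚ S (C (f z) - mapCoeffHom f b) := by
  by_contra! hlt
  set v := addVal ℚ S
  have hC : ∀ r : S, 0 ≤ v (C r) := fun r => by
    rcases eq_or_ne r 0 with rfl | hr
    · simp
    · simp [v, HahnSeries.C_apply, hr]
  have h0 : v (C (f z) - mapCoeffHom f b) ≥ 0 := by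
    by_contra! hneg
    refine hlt.ne ?_
    have hadd : C e - mapCoeffHom f b = C (e - f z) + (C (f z) - mapCoeffHom f b) := by
      rw [map_sub]; ring
    rw [hadd]
    exact (AddValuation.map_add_eq_of_lt_right v (hneg.trans_le (hC _))).symm
  have hpos : 0 < v (C e - mapCoeffHom f b) := h0.trans_lt hlt
  have hcoeff : (C e - mapCoeffHom f b).coeff 0 = 0 :=
    coeff_eq_zero_of_lt_orderTop (by simpa [v, addVal_apply] using hpos)
  refine he ⟨b.coeff 0, ?_⟩
  rw [coeff_sub, sub_eq_zero] at hcoeff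
  simpa using hcoeff.symm

/-- If `P(d, Y) ≠ 0` and `P` splits over the Hahn series with coefficients in `R`, then every
root of `P(d, Y)` lies in `R`. -/
theorem mem_range_of_splits_expandAt {K R S : Type*} [Field K] [Field R] [CharZero R] [Field S]
    (i : K →+* R) (f : R →+* S) (d : K) {P : K[X][X]} (hP : P.map (evalRingHom d) ≠ 0)
    (hsplit : (P.map (expandAt i d)).Splits) {e : S}
    (he : eval₂ ((f.comp i).comp (evalRingHom d)) e P = 0) : e ∈ f.range := by
  by_contra hmem
  obtain ⟨z, hz⟩ : ∃ z : R, eval z ((P.map (evalRingHom d)).map i) ≠ 0 := by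
    by_contra! hall
    exact (Polynomial.map_ne_zero (f := i) hP) (Polynomial.funext fun z => by simpa using hall z)
  have hfac : ∀ x : S, eval₂ (expandAt (f.comp i) d) (HahnSeries.C x) P =
      HahnSeries.mapCoeffHom f (P.map (expandAt i d)).leadingCoeff *
      ((P.map (expandAt i d)).roots.map fun b =>
        HahnSeries.C x - HahnSeries.mapCoeffHom f b).prod := fun x => by
    rw [← mapCoeffHom_comp_expandAt, ← eval₂_map]
    conv_lhs => rw [hsplit.eq_prod_roots]
    rw [eval₂_mul, eval₂_C, eval₂_multiset_prod]
    simp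
  obtain ⟨s, hs, hs0⟩ := exists_eval₂_expandAt (f.comp i) d P e
  obtain ⟨t, ht, ht0⟩ := exists_eval₂_expandAt (f.comp i) d P (f z)
  have h1 := HahnSeries.addVal_ofPowerSeries_pos (hs0.trans he)
  have h2 : HahnSeries.addVal ℚ S (HahnSeries.ofPowerSeries ℚ S t) ≤ 0 := by
    refine HahnSeries.addVal_ofPowerSeries_le_zero ?_
    rw [ht0, RingHom.comp_assoc, ← hom_eval₂]
    simpa [eval_map, eval₂_map] using hz
  rw [← hs, hfac, AddValuation.map_mul] at h1
  rw [← ht, hfac, AddValuation.map_mul] at h2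
  refine (h2.trans_lt h1).not_ge (add_le_add_right ?_ _)
  exact AddValuation.multiset_prod_map_le _ _ _ _ fun b _ =>
    HahnSeries.addVal_C_sub_le f hmem z b

/-- If the subfield `K` lies in the image of `φ : F →+* ℝ`, an element of `Qclo K` annihilated
by `W` is already annihilated by the divisor of `W` collecting the factors that split over a
field with all square roots. -/
theorem eval₂_eq_zero_of_mem_Qclo {F H : Type*} [Field F] [Field H] [Algebra F H]
    (hH : ∀ h : H, IsSquare h) (φ : F →+* ℝ) {K : Subfield ℝ} (hK : K ≤ φ.fieldRange) {W P : F[X]}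
    (hP : ∀ q, Irreducible q → (q.map (algebraMap F H)).Splits → q ∣ W → q ∣ P) {y : ℝ}
    (hy : y ∈ Qclo K) (hW : eval₂ φ y W = 0) : eval₂ φ y P = 0 := by
  let _ : Algebra F ℝ := φ.toAlgebra
  obtain ⟨M, hsq, hM⟩ := exists_subfield_splits (F := F) (E := ℝ) hH
  have hle : Qclo K ≤ M.toSubfield := by
    refine Qclo_le (fun x hx => ?_) fun x hx h0 => hsq _ ?_
    · obtain ⟨r, rfl⟩ := hK hx
      exact M.algebraMap_mem r
    · rwa [Real.sq_sqrt h0]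
  obtain ⟨hint, hsplit⟩ := hM y (hle hy)
  obtain ⟨g, hg⟩ := hP _ (minpoly.irreducible hint) hsplit (minpoly.dvd F y hW)
  have : aeval y P = 0 := by rw [hg, map_mul, minpoly.aeval, zero_mul]
  exact this

/-- Evaluation at a real number of polynomials over a subfield of `ℝ`. -/
noncomputable def evalReal (K : Subfield ℝ) (c : ℝ) : K[X] →+* ℝ := eval₂RingHom K.subtype c

theorem continuous_eval₂_evalReal {K : Subfield ℝ} (P : K[X][X]) :
    Continuous fun p : ℝ × ℝ => eval₂ (evalReal K p.1) p.2 P := by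
  have hc : ∀ q : K[X], Continuous fun p : ℝ × ℝ => evalReal K p.1 q := fun q => by
    simp only [evalReal, coe_eval₂RingHom, ← eval_map]
    exact (Polynomial.continuous _).comp continuous_fst
  simp only [eval₂_eq_sum_range]
  exact continuous_finsetSum _ fun n _ => (hc _).mul (continuous_snd.pow n)

/-- A nonzero polynomial in two variables with coefficients in the subfield `K` viewed as a
polynomial over `K[X]`. -/
theorem exists_bivariate {K : Subfield ℝ} {W : MvPolynomial (Fin 2) ℝ} (hW : W ≠ 0)
    (hWK : ∀ mo, MvPolynomial.coeff mo W ∈ K) :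
    ∃ P : K[X][X], P ≠ 0 ∧ ∀ c y, eval₂ (evalReal K c) y P = MvPolynomial.eval ![c, y] W := by
  obtain ⟨V, rfl⟩ : W ∈ (MvPolynomial.map (σ := Fin 2) K.subtype).range := by
    change W ∈ Set.range _
    rw [MvPolynomial.mem_range_map_iff_coeffs_subset]
    intro x hx
    obtain ⟨n, -, rfl⟩ := MvPolynomial.mem_coeffs_iff.1 hx
    exact ⟨⟨_, hWK n⟩, rfl⟩
  let α : MvPolynomial (Fin 2) K →+* K[X][X] :=
    MvPolynomial.eval₂Hom (C.comp C) ![C X, X]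
  let β : K[X][X] →+* MvPolynomial (Fin 2) K :=
    eval₂RingHom (eval₂RingHom MvPolynomial.C (MvPolynomial.X 0)) (MvPolynomial.X 1)
  have hβα : β.comp α = RingHom.id _ := by
    refine MvPolynomial.ringHom_ext (fun r => by simp [α, β]) fun j => ?_
    fin_cases j <;> simp [α, β]
  refine ⟨α V, fun h0 => hW ?_, fun c y => ?_⟩
  · have h1 : V = 0 := by
      rw [← RingHom.id_apply V, ← hβα, RingHom.comp_apply, h0, map_zero]
    rw [h1]
    exact map_zero _
  · change ((eval₂RingHom (evalReal K c) y).comp α) V =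
      ((MvPolynomial.eval ![c, y]).comp (MvPolynomial.map K.subtype)) V
    congr 1
    refine MvPolynomial.ringHom_ext (fun r => by simp [α, evalReal]) fun j => ?_
    fin_cases j <;> simp [α, evalReal]

/-- Removing the largest power of `X - d` from the coefficients makes the specialization at `d`
nonzero. -/
theorem exists_eq_C_pow_mul {K : Type*} [Field K] (d : K) {P : K[X][X]} (hP : P ≠ 0) :
    ∃ (n : ℕ) (Q : K[X][X]), P = C ((X - C d) ^ n) * Q ∧ Q.map (evalRingHom d) ≠ 0 := by
  have hprime : Prime (C (X - C d) : K[X][X]) := prime_C_iff.2 (prime_X_sub_C d)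
  obtain ⟨Q, hQ, hnd⟩ := (FiniteMultiplicity.of_prime_left hprime hP).exists_eq_pow_mul_and_not_dvd
  refine ⟨_, Q, by rw [C_pow]; exact hQ, fun h0 => hnd ((C_dvd_iff_dvd_coeff _ _).2 fun j => ?_)⟩
  rw [dvd_iff_isRoot]
  simpa using congrArg (fun q => coeff q j) h0

/-- A nonzero bivariate polynomial can be replaced by one that splits over a field `H` with all
square roots, remains nonzero at `d`, and keeps the constructible roots at every
transcendental point. -/
theorem exists_splits_comp (F : Type*) {H : Type*} {K : Subfield ℝ} [Field F] [Field H]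
    [Algebra K[X] F] [IsFractionRing K[X] F] (hH : ∀ h : H, IsSquare h)
    {θ : K[X] →+* H} (hθ : Function.Injective θ) (d : K) {V : K[X][X]} (hV : V ≠ 0) :
    ∃ Q : K[X][X], Q.map (evalRingHom d) ≠ 0 ∧ (Q.map θ).Splits ∧
      ∀ c : ℝ, c ≠ d → Transcendental K c →
        ∀ y ∈ Qclo (Subfield.closure (insert c (K : Set ℝ))),
          eval₂ (evalReal K c) y V = 0 → eval₂ (evalReal K c) y Q = 0 := by
  let ψ : F →+* H := IsFractionRing.lift hθ
  let _ : Algebra F H := ψ.toAlgebra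
  have hψ : (algebraMap F H).comp (algebraMap K[X] F) = θ :=
    RingHom.ext fun q => IsFractionRing.lift_algebraMap hθ q
  have hinj : Function.Injective (algebraMap K[X] F) := IsFractionRing.injective _ _
  have hVF : V.map (algebraMap K[X] F) ≠ 0 := (Polynomial.map_ne_zero_iff hinj).2 hV
  obtain ⟨P, hP0, hPs, hP⟩ := exists_split_factor (H := H) hVF
  obtain ⟨b, hbM, hb⟩ := IsLocalization.integerNormalization_spec (nonZeroDivisors K[X]) P
  set P₀ := IsLocalization.integerNormalization (nonZeroDivisors K[X]) P
  have hb' : P₀.map (algebraMap K[X] F) = C (algebraMap K[X] F b) * P := by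
    rw [hb, ← algebraMap_smul F b P, smul_eq_C_mul]
  have hbF : algebraMap K[X] F b ≠ 0 :=
    (map_ne_zero_iff _ hinj).2 (nonZeroDivisors.ne_zero hbM)
  have hP₀F : P₀.map (algebraMap K[X] F) ≠ 0 := by
    rw [hb']
    exact mul_ne_zero (C_ne_zero.2 hbF) hP0
  have hP₀ : P₀ ≠ 0 := fun h => hP₀F (by rw [h, Polynomial.map_zero])
  obtain ⟨n, Q, hQ, hQd⟩ := exists_eq_C_pow_mul d hP₀
  refine ⟨Q, hQd, ?_, fun c hcd htr y hy hVy => ?_⟩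
  · rw [← hψ, ← Polynomial.map_map]
    refine Splits.of_dvd (g := (P₀.map (algebraMap K[X] F)).map (algebraMap F H)) ?_
      (Polynomial.map_ne_zero hP₀F)
      (Polynomial.map_dvd _ (Polynomial.map_dvd _ (Dvd.intro_left _ hQ.symm)))
    rw [hb', Polynomial.map_mul, map_C]
    exact (Splits.C _).mul hPs
  · have hcinj : Function.Injective (evalReal K c) :=
      transcendental_iff_injective.1 htr
    let φ : F →+* ℝ := IsFractionRing.lift hcinj
    have hφ : φ.comp (algebraMap K[X] F) = evalReal K c :=
      RingHom.ext fun q => IsFractionRing.lift_algebraMap hcinj q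
    have hφ' : ∀ q, φ (algebraMap K[X] F q) = evalReal K c q := fun q => DFunLike.congr_fun hφ q
    have hrange : Subfield.closure (insert c (K : Set ℝ)) ≤ φ.fieldRange := by
      refine Subfield.closure_le.2 (Set.insert_subset ?_ ?_)
      · exact ⟨algebraMap K[X] F X, by rw [hφ']; simp [evalReal]⟩
      · exact fun x hx => ⟨algebraMap K[X] F (C ⟨x, hx⟩), by rw [hφ']; simp [evalReal]⟩
    have hPc : eval₂ φ y P = 0 := by
      refine eval₂_eq_zero_of_mem_Qclo hH φ hrange hP hy ?_
      rw [eval₂_map, hφ, hVy]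
    have hP₀c : eval₂ (evalReal K c) y P₀ = 0 := by
      rw [← hφ, ← eval₂_map, hb', eval₂_mul, hPc, mul_zero]
    rw [hQ, eval₂_mul, eval₂_C, map_pow] at hP₀c
    refine (mul_eq_zero.1 hP₀c).resolve_left (pow_ne_zero _ ?_)
    simpa [evalReal] using sub_ne_zero.2 hcd

/-- Limit Theorem for geometric constructibility.  If `d` is constructible from
`a₁,…,aₘ`, there are `ε > 0` and a nonzero two-variable polynomial `W` with
constructible coefficients such that `W(c, u c) = 0` and `u c` is constructible from
`a₁,…,aₘ,c` for every transcendental `c ∈ (d, d+ε)`, and `u(x) → L` as `x → d⁺`,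
then `L` is constructible from `a₁,…,aₘ`. -/
theorem statement14 (m : ℕ) (a : Fin m → ℝ) (d : ℝ) (u : ℝ → ℝ) (L : ℝ)
    (hd : d ∈ Qclo (Subfield.closure (Set.range a)))
    (hex : ∃ ε : ℝ, 0 < ε ∧ ∃ W : MvPolynomial (Fin 2) ℝ, W ≠ 0 ∧
      (∀ mo : Fin 2 →₀ ℕ, MvPolynomial.coeff mo W ∈ Qclo (Subfield.closure (Set.range a))) ∧
      (∀ c ∈ Set.Ioo d (d + ε), TranscOver (Subfield.closure (Set.range a)) c →
        MvPolynomial.eval ![c, u c] W = 0) ∧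
      (∀ c ∈ Set.Ioo d (d + ε), TranscOver (Subfield.closure (Set.range a)) c →
        u c ∈ Qclo (Subfield.closure (insert c (Set.range a)))))
    (hlim : Tendsto u (nhdsWithin d (Set.Ioi d)) (nhds L)) :
    L ∈ Qclo (Subfield.closure (Set.range a)) := by
  obtain ⟨ε, hε, W, hW0, hWK, hWu, hu⟩ := hex
  set K₀ := Subfield.closure (Set.range a)
  set K := Qclo K₀
  obtain ⟨V, hV0, hV⟩ := exists_bivariate hW0 hWK
  have ha : Set.range a ⊆ K := fun x hx => le_Qclo _ (Subfield.subset_closure hx)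
  let R := complexSubfield K
  let i : K →+* R := (Complex.ofRealHom.comp K.subtype).codRestrict R fun x => by
    simp [R, complexSubfield]
  let d' : K := ⟨d, hd⟩
  have hsq : ∀ r : R, IsSquare r := isSquare_complexSubfield fun c hc => sqrt_mem_Qclo hc
  obtain ⟨Q, hQd, hQs, hQ⟩ := exists_splits_comp (FractionRing K[X])
    (HahnSeries.isSquare_of_forall_isSquare hsq) (expandAt_injective i d') d' hV0
  have hroot : ∀ c ∈ Set.Ioo d (d + ε), TranscOver K₀ c → eval₂ (evalReal K c) (u c) Q = 0 :=
    fun c hc htr => hQ c hc.1.ne' htr.transcendental_Qclo (u c)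
      (Qclo_mono (Subfield.closure_mono (Set.insert_subset_insert ha)) (hu c hc htr))
      ((hV c (u c)).trans (hWu c hc htr))
  have hlimQ : Tendsto (fun x => eval₂ (evalReal K x) (u x) Q) (nhdsWithin d (Set.Ioi d))
      (nhds (eval₂ (evalReal K d) L Q)) :=
    ((continuous_eval₂_evalReal Q).tendsto (d, L)).comp
      ((tendsto_id.mono_left nhdsWithin_le_nhds).prodMk_nhds hlim)
  have hfreq : ∃ᶠ x in nhdsWithin d (Set.Ioi d),
      eval₂ (evalReal K x) (u x) Q ∈ ({0} : Set ℝ) :=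
    ((frequently_transcOver (countable_closure_range a) d).and_eventually
      (Ioo_mem_nhdsGT (by linarith : d < d + ε))).mono fun x hx => hroot x hx.2 hx.1
  have hQL : eval₂ (evalReal K d) L Q = 0 :=
    isClosed_singleton.mem_of_frequently_of_tendsto hfreq hlimQ
  have hmem : (L : ℂ) ∈ R.subtype.range := by
    refine mem_range_of_splits_expandAt i R.subtype d' hQd hQs ?_
    have hcomp : (R.subtype.comp i).comp (evalRingHom d') =
        Complex.ofRealHom.comp (evalReal K d) := by
      have hi : R.subtype.comp i = Complex.ofRealHom.comp K.subtype := rfl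
      rw [hi]
      ext <;> simp [evalReal, d']
    have := congrArg Complex.ofRealHom hQL
    rw [hom_eval₂, map_zero] at this
    rw [hcomp]
    exact this
  obtain ⟨z, hz⟩ := hmem
  have hzre := z.2.1
  rw [show (z : ℂ) = L from hz] at hzre
  simpa using hzre
end

section
/- For every integer n ≥ 8, let ℓ = 7 if n ≠ 14 and ℓ = 9 if n = 14. Then there exist a real number c ∈ (0,1) transcendental over ℚ, a real number u > 0, and α, β ∈ (0, π/2) such that ℓ·α + (n−ℓ)·β = π, sin α = u and sin β = c·u, and u does not belong to Qclo(ℚ(c)). (This expresses that the cyclic n-gon with ℓ sides of length 1 and n−ℓ sides of length c exists but is not constructible with straightedge and compass from 1 and c.) -/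
open Real

/-- The value at `x` of the monic cubic with integer coefficients `1, p, q, r`. -/
def monicCubic {K : Type*} [Field K] (p q r : ℤ) (x : K) : K :=
  x ^ 3 + p * x ^ 2 + q * x + r

/-- No element of `M` reduces to a root of the cubic in the residue field of `V`. -/
def HasNoResidualRoot {K : Type*} [Field K] (V : ValuationSubring K) (p q r : ℤ)
    (M : Subfield K) : Prop :=
  ∀ x ∈ M, 1 ≤ V.valuation (monicCubic p q r x)

section Valuation

variable {K : Type*} [Field K] (V : ValuationSubring K)

theorem valuation_mul_lt_one {a b : K} (ha : V.valuation a < 1) (hb : b ∈ V) :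
    V.valuation (a * b) < 1 := by
  rw [map_mul]
  exact mul_lt_one_of_lt_of_le ha ((V.valuation_le_one_iff b).2 hb)

theorem mem_of_valuation_lt_one {a : K} (ha : V.valuation a < 1) : a ∈ V :=
  (V.valuation_le_one_iff a).1 ha.le

theorem valuation_sub_lt_one {a b : K} (ha : V.valuation a < 1) (hb : V.valuation b < 1) :
    V.valuation (a - b) < 1 :=
  V.valuation.map_sub_lt ha hb

theorem mem_of_valuation_monicCubic_lt_one {p q r : ℤ} {x : K}
    (h : V.valuation (monicCubic p q r x) < 1) : x ∈ V := by
  by_contra hx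
  have hx0 : x ≠ 0 := by
    rintro rfl
    exact hx V.zero_mem
  have hy : V.valuation x⁻¹ < 1 := by
    rw [map_inv₀]
    refine inv_lt_one_of_one_lt₀ ?_
    rw [← not_le, V.valuation_le_one_iff]
    exact hx
  have hyV := mem_of_valuation_lt_one V hy
  have hG : (p : K) + q * x⁻¹ + r * x⁻¹ ^ 2 ∈ V := by
    apply_rules [add_mem, mul_mem, pow_mem, intCast_mem]
  have h1 := valuation_sub_lt_one V (valuation_mul_lt_one V h (pow_mem hyV 3))
    (valuation_mul_lt_one V hy hG)
  have h2 : monicCubic p q r x * x⁻¹ ^ 3 - x⁻¹ * ((p : K) + q * x⁻¹ + r * x⁻¹ ^ 2) = 1 := by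
    unfold monicCubic
    field_simp
    ring
  rw [h2, map_one] at h1
  exact lt_irrefl _ h1

theorem valuation_monicCubic_lt_one_of_sub {p q r : ℤ} {x y : K} (hx : x ∈ V)
    (h : V.valuation (monicCubic p q r x) < 1) (hxy : V.valuation (y - x) < 1) :
    V.valuation (monicCubic p q r y) < 1 := by
  have hy : y ∈ V := by
    have := add_mem (mem_of_valuation_lt_one V hxy) hx
    simpa using this
  have hG : y ^ 2 + y * x + x ^ 2 + p * (y + x) + q ∈ V := by
    apply_rules [add_mem, mul_mem, pow_mem, intCast_mem]
  have h1 := V.valuation.map_add_lt h (valuation_mul_lt_one V hxy hG)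
  convert h1 using 2
  unfold monicCubic
  ring

theorem HasNoResidualRoot.one_le_of_quadratic {p q r : ℤ} {M : Subfield K}
    (hM : HasNoResidualRoot V p q r M) {t n x : K} (ht : t ∈ M) (hn : n ∈ M)
    (hx : x ^ 2 = t * x - n) : 1 ≤ V.valuation (monicCubic p q r x) := by
  by_contra! h
  have hxV := mem_of_valuation_monicCubic_lt_one V h
  by_cases htV : t ∈ V
  · have hnV : n ∈ V := by
      have : n = t * x - x ^ 2 := by rw [hx]; ring
      rw [this]
      exact sub_mem (mul_mem htV hxV) (pow_mem hxV 2)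
    set A : K := q - n + t * (p + t) with hA
    set B : K := r - n * (p + t) with hB
    have hlin : monicCubic p q r x = A * x + B := by
      unfold monicCubic
      have : x ^ 3 = x * (t * x - n) := by rw [← hx]; ring
      rw [this, hA, hB]
      linear_combination (t + p) * hx
    have hAV : A ∈ V := by
      apply_rules [add_mem, sub_mem, mul_mem, intCast_mem]
    have hAM : A ∈ M := by
      apply_rules [add_mem, sub_mem, mul_mem, intCast_mem]
    have hBM : B ∈ M := by
      apply_rules [add_mem, sub_mem, mul_mem, intCast_mem]
    rcases lt_or_eq_of_le ((V.valuation_le_one_iff A).2 hAV) with hA1 | hA1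
    · have hB1 : V.valuation B < 1 := by
        have := valuation_sub_lt_one V h (valuation_mul_lt_one V hA1 hxV)
        rwa [hlin, add_sub_cancel_left] at this
      have hs : -(p + t) ∈ M := neg_mem (add_mem (intCast_mem _ _) ht)
      have hsV : -(p + t) ∈ V := neg_mem (add_mem (intCast_mem _ _) htV)
      refine (hM _ hs).not_gt ?_
      have := V.valuation.map_add_lt (valuation_mul_lt_one V hA1 hsV) hB1
      convert this using 2
      rw [hA, hB]
      unfold monicCubic
      ring
    · have hA0 : A ≠ 0 := by
        rintro h0
        rw [h0, map_zero] at hA1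
        exact zero_ne_one hA1
      refine (hM (-B / A) (div_mem (neg_mem hBM) hAM)).not_gt
        (valuation_monicCubic_lt_one_of_sub V hxV h ?_)
      have : -B / A - x = -(monicCubic p q r x / A) := by
        rw [hlin]
        field_simp
        ring
      rw [this, Valuation.map_neg, map_div₀, hA1, div_one]
      exact h
  · have ht0 : t ≠ 0 := by
      rintro rfl
      exact htV V.zero_mem
    refine (hM (n / t) (div_mem hn ht)).not_gt (valuation_monicCubic_lt_one_of_sub V hxV h ?_)
    have h1 : n / t - x = -(t⁻¹ * x ^ 2) := by
      rw [hx]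
      field_simp
      ring
    rw [h1, Valuation.map_neg]
    refine valuation_mul_lt_one V ?_ (pow_mem hxV 2)
    rw [map_inv₀]
    refine inv_lt_one_of_one_lt₀ ?_
    rw [← not_le, V.valuation_le_one_iff]
    exact htV

theorem exists_eq_add_mul_of_mem_closure_insert {M : Subfield K} {s : K} (hs : s ∉ M)
    (hs2 : s ^ 2 ∈ M) {x : K} (hx : x ∈ Subfield.closure (insert s (M : Set K))) :
    ∃ a ∈ M, ∃ b ∈ M, x = a + b * s := by
  induction hx using Subfield.closure_induction with
  | mem x hx =>
    rcases hx with rfl | hx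
    · exact ⟨0, zero_mem _, 1, one_mem _, by ring⟩
    · exact ⟨x, hx, 0, zero_mem _, by ring⟩
  | one => exact ⟨1, one_mem _, 0, zero_mem _, by ring⟩
  | add x y _ _ hx hy =>
    obtain ⟨a, ha, b, hb, rfl⟩ := hx
    obtain ⟨a', ha', b', hb', rfl⟩ := hy
    exact ⟨a + a', add_mem ha ha', b + b', add_mem hb hb', by ring⟩
  | neg x _ hx =>
    obtain ⟨a, ha, b, hb, rfl⟩ := hx
    exact ⟨-a, neg_mem ha, -b, neg_mem hb, by ring⟩
  | mul x y _ _ hx hy =>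
    obtain ⟨a, ha, b, hb, rfl⟩ := hx
    obtain ⟨a', ha', b', hb', rfl⟩ := hy
    exact ⟨a * a' + b * b' * s ^ 2, add_mem (mul_mem ha ha') (mul_mem (mul_mem hb hb') hs2),
      a * b' + b * a', add_mem (mul_mem ha hb') (mul_mem hb ha'), by ring⟩
  | inv x _ hx =>
    obtain ⟨a, ha, b, hb, rfl⟩ := hx
    have conj_ne : ∀ b' ∈ M, b' ≠ 0 → a + b' * s ≠ 0 := by
      intro b' hb' hb0 h
      refine hs ?_
      have : s = -a / b' := by
        field_simp
        linear_combination h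
      rw [this]
      exact div_mem (neg_mem ha) hb'
    by_cases hb0 : b = 0
    · exact ⟨a⁻¹, inv_mem ha, 0, zero_mem _, by simp [hb0]⟩
    · have h1 := conj_ne b hb hb0
      have h2 := conj_ne (-b) (neg_mem hb) (neg_ne_zero.2 hb0)
      have h3 : a ^ 2 - b ^ 2 * s ^ 2 ≠ 0 := by
        have := mul_ne_zero h1 h2
        convert this using 1
        ring
      have h4 : a ^ 2 - b ^ 2 * s ^ 2 ∈ M :=
        sub_mem (pow_mem ha 2) (mul_mem (pow_mem hb 2) hs2)
      refine ⟨a / (a ^ 2 - b ^ 2 * s ^ 2), div_mem ha h4, -b / (a ^ 2 - b ^ 2 * s ^ 2),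
        div_mem (neg_mem hb) h4, ?_⟩
      refine inv_eq_of_mul_eq_one_right ?_
      field_simp
      ring

theorem HasNoResidualRoot.closure_insert {p q r : ℤ} {M : Subfield K}
    (hM : HasNoResidualRoot V p q r M) {s : K} (hs : s ∉ M) (hs2 : s ^ 2 ∈ M) :
    HasNoResidualRoot V p q r (Subfield.closure (insert s (M : Set K))) := by
  intro x hx
  obtain ⟨a, ha, b, hb, rfl⟩ := exists_eq_add_mul_of_mem_closure_insert hs hs2 hx
  exact hM.one_le_of_quadratic V (t := a + a) (n := a ^ 2 - b ^ 2 * s ^ 2) (add_mem ha ha)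
    (sub_mem (pow_mem ha 2) (mul_mem (pow_mem hb 2) hs2)) (by ring)

theorem HasNoResidualRoot.exists_sqrt_closed {p q r : ℤ} {M₀ : Subfield K}
    (hM₀ : HasNoResidualRoot V p q r M₀) :
    ∃ M : Subfield K, M₀ ≤ M ∧ HasNoResidualRoot V p q r M ∧ ∀ s : K, s ^ 2 ∈ M → s ∈ M := by
  obtain ⟨M, hle, hmax⟩ := zorn_le_nonempty₀ {M | HasNoResidualRoot V p q r M}
    (fun S hS hchain M₁ hM₁ => ⟨sSup S, fun x hx => by
      rw [Subfield.mem_sSup_of_directedOn ⟨M₁, hM₁⟩ hchain.directedOn] at hx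
      obtain ⟨M, hMS, hxM⟩ := hx
      exact hS hMS x hxM, fun M hM => le_sSup hM⟩) M₀ hM₀
  refine ⟨M, hle, hmax.1, fun s hs2 => ?_⟩
  by_contra hs
  refine hs (hmax.2 (hmax.1.closure_insert V hs hs2) (fun x hx => ?_) ?_)
  · exact Subfield.subset_closure (Set.mem_insert_of_mem _ hx)
  · exact Subfield.subset_closure (Set.mem_insert _ _)

open Polynomial in
theorem hasNoResidualRoot_closure_singleton [CharZero K] {p q r : ℤ}
    (hroot : ∀ a : ℚ, monicCubic p q r a ≠ 0) (hQ : ∀ a : ℚ, (a : K) ∈ V) {c : K}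
    (hc : V.valuation c < 1) : HasNoResidualRoot V p q r (Subfield.closure {c}) := by
  have hcV := mem_of_valuation_lt_one V hc
  have hmem : ∀ R : ℚ[X], aeval c R ∈ V := by
    intro R
    rw [aeval_eq_sum_range]
    refine sum_mem fun i _ => ?_
    rw [Algebra.smul_def]
    exact mul_mem (hQ _) (pow_mem hcV i)
  have hunit : ∀ R : ℚ[X], R.coeff 0 ≠ 0 → 1 ≤ V.valuation (aeval c R) := by
    intro R h0
    by_contra! h
    have h1 := valuation_sub_lt_one V h (valuation_mul_lt_one V hc (hmem R.divX))
    have h2 : aeval c R - c * aeval c R.divX = (R.coeff 0 : K) := by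
      have h3 := congrArg (aeval c) (divX_mul_X_add R)
      rw [map_add, map_mul, aeval_X, aeval_C, eq_ratCast] at h3
      linear_combination -h3
    rw [h2] at h1
    have h3 := valuation_mul_lt_one V h1 (hQ (R.coeff 0)⁻¹)
    rw [Rat.cast_inv, mul_inv_cancel₀ (by exact_mod_cast h0), map_one] at h3
    exact lt_irrefl _ h3
  have hcop : ∀ R S : ℚ[X], IsCoprime R S → aeval c S ≠ 0 →
      1 ≤ V.valuation (monicCubic p q r (aeval c R / aeval c S)) := by
    intro R S hRS hS
    by_contra! h
    have h1 := valuation_mul_lt_one V h (pow_mem (hmem S) 3)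
    set N : ℚ[X] := R ^ 3 + C (p : ℚ) * R ^ 2 * S + C (q : ℚ) * R * S ^ 2 + C (r : ℚ) * S ^ 3
      with hN
    have h2 : monicCubic p q r (aeval c R / aeval c S) * aeval c S ^ 3 = aeval c N := by
      rw [hN]
      unfold monicCubic
      simp
      field_simp
    rw [h2] at h1
    refine (hunit N ?_).not_gt h1
    intro hN0
    rw [coeff_zero_eq_eval_zero, hN] at hN0
    simp only [eval_add, eval_mul, eval_pow, eval_C] at hN0
    by_cases hS0 : S.eval 0 = 0
    · have hR0 : R.eval 0 = 0 := by simpa [hS0] using hN0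
      obtain ⟨a, b, hab⟩ := hRS
      have := congrArg (eval 0) hab
      simp [hS0, hR0] at this
    · refine hroot (R.eval 0 / S.eval 0) ?_
      unfold monicCubic
      field_simp
      linear_combination hN0
  intro x hx
  have hx' : x ∈ IntermediateField.adjoin ℚ {c} := by
    have : Subfield.closure {c} ≤ (IntermediateField.adjoin ℚ {c}).toSubfield := by
      rw [Subfield.closure_le, Set.singleton_subset_iff]
      exact IntermediateField.mem_adjoin_simple_self ℚ c
    exact this hx
  obtain ⟨R, S, rfl⟩ := (IntermediateField.mem_adjoin_simple_iff ℚ x).1 hx'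
  by_cases hS : aeval c S = 0
  · have := hcop 0 1 isCoprime_one_right (by simp)
    simpa [hS] using this
  · have hS0 : S ≠ 0 := by
      rintro rfl
      simp at hS
    have hg : EuclideanDomain.gcd R S ≠ 0 := by
      intro h
      exact hS0 (EuclideanDomain.gcd_eq_zero_iff.1 h).2
    obtain ⟨R', hR'⟩ := EuclideanDomain.gcd_dvd_left R S
    obtain ⟨S', hS'⟩ := EuclideanDomain.gcd_dvd_right R S
    have hRS' : IsCoprime R' S' := by
      have h1 := EuclideanDomain.gcd_eq_gcd_ab R S
      refine ⟨EuclideanDomain.gcdA R S, EuclideanDomain.gcdB R S, mul_left_cancel₀ hg ?_⟩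
      generalize EuclideanDomain.gcdA R S = A at *
      generalize EuclideanDomain.gcdB R S = B at *
      generalize EuclideanDomain.gcd R S = g at *
      subst hR' hS'
      linear_combination -h1
    generalize EuclideanDomain.gcd R S = g at *
    subst hR' hS'
    rw [map_mul] at hS
    rw [map_mul, map_mul, mul_div_mul_left _ _ (left_ne_zero_of_mul hS)]
    exact hcop R' S' hRS' (right_ne_zero_of_mul hS)

end Valuation

/-- If `(c, u)` specializes to `(0, s)` over `ℚ`, and `2 - 4s²` is a root of an integral cubic
without rational roots, then `u` is not constructible from `c`. -/
theorem not_mem_Qclo_of_specialization {p q r : ℤ} (hroot : ∀ a : ℚ, monicCubic p q r a ≠ 0)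
    {c u s : ℝ} (hs : monicCubic p q r (2 - 4 * s ^ 2) = 0)
    (hspec : ∀ H : MvPolynomial (Fin 2) ℚ, MvPolynomial.aeval ![c, u] H = 0 →
      MvPolynomial.aeval ![0, s] H = 0) :
    u ∉ Qclo (Subfield.closure {c}) := by
  intro hu
  set φ := MvPolynomial.aeval (R := ℚ) ![c, u] with hφ
  set ψ := MvPolynomial.aeval (R := ℚ) ![0, s] with hψ
  let A : Subring ℝ := φ.range.toSubring
  let Y : MvPolynomial (Fin 2) ℚ := 2 - 4 * MvPolynomial.X 1 ^ 2
  let F : MvPolynomial (Fin 2) ℚ := Y ^ 3 + p * Y ^ 2 + q * Y + r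
  let xc : A := ⟨φ (MvPolynomial.X 0), MvPolynomial.X 0, rfl⟩
  let xf : A := ⟨φ F, F, rfl⟩
  have hI : Ideal.span {xc, xf} ≠ ⊤ := by
    rw [Ne, Ideal.eq_top_iff_one, Ideal.mem_span_pair]
    rintro ⟨⟨_, a, rfl⟩, ⟨_, b, rfl⟩, hab⟩
    have h1 : φ a * φ (MvPolynomial.X 0) + φ b * φ F = 1 := congrArg Subtype.val hab
    have h2 := hspec (a * MvPolynomial.X 0 + b * F - 1) (by
      rw [map_sub, map_add, map_mul, map_mul, h1, map_one, sub_self])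
    change ψ _ = 0 at h2
    have h3 : ψ F = 0 := by
      unfold monicCubic at hs
      simpa [F, Y, hψ] using hs
    rw [map_sub, map_add, map_mul, map_mul, h3] at h2
    simp [hψ] at h2
  obtain ⟨V, hAV, hV⟩ := Ideal.image_subset_nonunits_valuationSubring _ hI
  have hc : V.valuation c < 1 := by
    have : c ∈ V.nonunits :=
      hV ⟨xc, Ideal.subset_span (by simp), by simp [xc, hφ]⟩
    exact this
  have hf : V.valuation (monicCubic p q r (2 - 4 * u ^ 2)) < 1 := by
    have : monicCubic p q r (2 - 4 * u ^ 2) ∈ V.nonunits :=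
      hV ⟨xf, Ideal.subset_span (by simp), by simp [xf, hφ, F, Y, monicCubic]⟩
    exact this
  have hQ : ∀ a : ℚ, (a : ℝ) ∈ V := fun a => hAV ⟨MvPolynomial.C a, by simp [hφ]⟩
  obtain ⟨M, hcM, hM, hsqrt⟩ :=
    (hasNoResidualRoot_closure_singleton V hroot hQ hc).exists_sqrt_closed V
  have huM : u ∈ M := by
    have : Qclo (Subfield.closure {c}) ≤ M :=
      sInf_le ⟨hcM, fun d hd hd0 => hsqrt _ (by rwa [Real.sq_sqrt hd0])⟩
    exact this hu
  refine (hM _ ?_).not_gt hf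
  exact sub_mem (ofNat_mem M 2) (mul_mem (ofNat_mem M 4) (pow_mem huM 2))

open Polynomial in
theorem transcOver_bot_of_specialization {c : ℝ} (hc0 : c ≠ 0)
    (hspec : ∀ R : ℚ[X], aeval c R = 0 → R.eval 0 = 0) : TranscOver ⊥ c := by
  have key : ∀ R : ℚ[X], aeval c R = 0 → R = 0 := by
    intro R hR
    by_contra hR0
    obtain ⟨S, hS, hdvd⟩ := exists_eq_pow_rootMultiplicity_mul_and_not_dvd R hR0 0
    rw [C_0, sub_zero] at hS hdvd
    refine hdvd ?_
    rw [X_dvd_iff, coeff_zero_eq_eval_zero]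
    refine hspec S ?_
    rw [hS, map_mul, map_pow, aeval_X] at hR
    exact (mul_eq_zero.1 hR).resolve_left (pow_ne_zero _ hc0)
  intro P hP hPc
  have hlift : P ∈ lifts (algebraMap ℚ ℝ) := by
    rw [lifts_iff_coeff_lifts]
    intro i
    have h1 : (⊥ : Subfield ℝ) ≤ (algebraMap ℚ ℝ).fieldRange := bot_le
    exact h1 (hP i)
  obtain ⟨R, rfl⟩ := hlift
  have : R = 0 := key R (by simpa [aeval_def, eval_map] using hPc)
  simp [this]

theorem finite_zeros_of_aeval_ne_zero {b : ℝ} (hb : 0 < b) {f : ℝ → Fin 2 → ℝ}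
    (hf : ∀ i, AnalyticOnNhd ℝ (f · i) (Set.Icc 0 b)) (H : MvPolynomial (Fin 2) ℚ)
    (hH : MvPolynomial.aeval (f 0) H ≠ 0) :
    {t ∈ Set.Icc 0 b | MvPolynomial.aeval (f t) H = 0}.Finite := by
  by_contra hinf
  obtain ⟨x, hx, hacc⟩ := Set.Infinite.exists_accPt_of_subset_isCompact hinf isCompact_Icc
    (Set.sep_subset _ _)
  have han : AnalyticOnNhd ℝ (fun t => MvPolynomial.aeval (f t) H) (Set.Icc 0 b) :=
    AnalyticOnNhd.aeval_mvPolynomial hf H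
  have hfreq := (accPt_iff_frequently_nhdsNE.1 hacc).mono fun t ht => ht.2
  exact hH (han.eqOn_zero_of_preconnected_of_frequently_eq_zero isPreconnected_Icc hx hfreq
    (Set.left_mem_Icc.2 hb.le))

/-- Countably many relations with rational coefficients between two functions analytic on a
compact interval hold at a suitably generic point only if they hold at the left endpoint. -/
theorem exists_generic_point {b : ℝ} (hb : 0 < b) {f : ℝ → Fin 2 → ℝ}
    (hf : ∀ i, AnalyticOnNhd ℝ (f · i) (Set.Icc 0 b)) :
    ∃ t ∈ Set.Ioc 0 b, ∀ H : MvPolynomial (Fin 2) ℚ,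
      MvPolynomial.aeval (f t) H = 0 → MvPolynomial.aeval (f 0) H = 0 := by
  have hcount : Countable (MvPolynomial (Fin 2) ℚ) := by
    rw [← Cardinal.mk_le_aleph0_iff]
    refine MvPolynomial.cardinalMk_le_max.trans ?_
    simp
  by_contra! hcon
  choose! H hH using hcon
  have hsub : Set.Ioc 0 b ⊆ ⋃ P ∈ {P : MvPolynomial (Fin 2) ℚ | MvPolynomial.aeval (f 0) P ≠ 0},
      {t ∈ Set.Icc 0 b | MvPolynomial.aeval (f t) P = 0} := fun t ht =>
    Set.mem_biUnion (hH t ht).2 ⟨Set.Ioc_subset_Icc_self ht, (hH t ht).1⟩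
  have hc : (Set.Ioc 0 b).Countable :=
    ((Set.to_countable _).biUnion fun P hP =>
      (finite_zeros_of_aeval_ne_zero hb hf P hP).countable).mono hsub
  rw [← Cardinal.le_aleph0_iff_set_countable, Cardinal.mk_Ioc_real hb] at hc
  exact hc.not_gt Cardinal.aleph0_lt_continuum

theorem exists_nonconstructible_cyclic_polygon {n l : ℕ} (hl : 3 ≤ l) (hln : l < n) {p q r : ℤ}
    (hroot : ∀ a : ℚ, monicCubic p q r a ≠ 0)
    (hcos : monicCubic p q r (2 * Real.cos (2 * (π / l))) = 0) :
    ∃ (c u α β : ℝ), c ∈ Set.Ioo (0 : ℝ) 1 ∧ TranscOver ⊥ c ∧ 0 < u ∧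
      α ∈ Set.Ioo 0 (π / 2) ∧ β ∈ Set.Ioo 0 (π / 2) ∧
      (l : ℝ) * α + ((n : ℝ) - (l : ℝ)) * β = π ∧
      Real.sin α = u ∧ Real.sin β = c * u ∧
      u ∉ Qclo (Subfield.closure {c}) := by
  have hl3 : (3 : ℝ) ≤ l := by exact_mod_cast hl
  have hl0 : (0 : ℝ) < l := by linarith
  have hln' : (l : ℝ) < n := by exact_mod_cast hln
  have hn0 : (0 : ℝ) < n := by linarith
  have hπ := Real.pi_pos
  set b : ℝ := π / (2 * n) with hb
  have hb0 : 0 < b := by positivity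
  have hnb : n * b = π / 2 := by
    rw [hb]
    field_simp
  let α : ℝ → ℝ := fun t => (π - (n - l) * t) / l
  have hlα : ∀ t, l * α t = π - (n - l) * t := fun t => by
    simp only [α]
    field_simp
  have hα : ∀ t ∈ Set.Icc 0 b, t < α t ∧ α t < π / 2 := by
    rintro t ⟨h0, h1⟩
    constructor
    · refine lt_of_mul_lt_mul_left ?_ hl0.le
      rw [hlα]
      nlinarith
    · refine lt_of_mul_lt_mul_left ?_ hl0.le
      rw [hlα]
      nlinarith
  have hsin : ∀ t ∈ Set.Icc 0 b, 0 < Real.sin (α t) := fun t ht =>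
    Real.sin_pos_of_pos_of_lt_pi (ht.1.trans_lt (hα t ht).1) (by linarith [(hα t ht).2])
  let f : ℝ → Fin 2 → ℝ := fun t => ![Real.sin t / Real.sin (α t), Real.sin (α t)]
  have hαan : ∀ t, AnalyticAt ℝ (fun t => Real.sin (α t)) t := by
    intro t
    simp only [α]
    fun_prop
  have hf : ∀ i, AnalyticOnNhd ℝ (f · i) (Set.Icc 0 b) := by
    intro i t ht
    fin_cases i
    · exact Real.analyticAt_sin.div (hαan t) (hsin t ht).ne'
    · exact hαan t
  obtain ⟨t, ht, hgen⟩ := exists_generic_point hb0 hf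
  have htI := Set.Ioc_subset_Icc_self ht
  obtain ⟨h1, h2⟩ := hα t htI
  have hsα := hsin t htI
  have hst : 0 < Real.sin t := Real.sin_pos_of_pos_of_lt_pi ht.1 (by linarith)
  have hlt : Real.sin t < Real.sin (α t) :=
    Real.sin_lt_sin_of_lt_of_le_pi_div_two (by linarith [ht.1]) h2.le h1
  have hf0 : f 0 = ![0, Real.sin (π / l)] := by
    simp [f, α]
  rw [hf0] at hgen
  refine ⟨Real.sin t / Real.sin (α t), Real.sin (α t), α t, t,
    ⟨div_pos hst hsα, (div_lt_one hsα).2 hlt⟩, ?_, hsα, ⟨ht.1.trans h1, h2⟩,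
    ⟨ht.1, h1.trans h2⟩, by rw [hlα]; ring, rfl, by field_simp, ?_⟩
  · refine transcOver_bot_of_specialization (div_pos hst hsα).ne' fun R hR => ?_
    have h3 := hgen (Polynomial.aeval (MvPolynomial.X 0) R) (by
      rw [← Polynomial.aeval_algHom_apply]
      simpa [f] using hR)
    rw [← Polynomial.aeval_algHom_apply] at h3
    have h4 : (Polynomial.aeval (0 : ℝ)) R = 0 := by simpa using h3
    rw [← map_zero (algebraMap ℚ ℝ), Polynomial.aeval_algebraMap_apply] at h4
    simpa using h4
  · refine not_mem_Qclo_of_specialization hroot (s := Real.sin (π / l)) ?_ hgen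
    rw [Real.cos_two_mul, Real.cos_sq'] at hcos
    convert hcos using 2
    ring

theorem monicCubic_ne_zero_of_odd {p q r : ℤ} (hr : Odd r) (hpq : Odd (p + q)) (a : ℚ) :
    monicCubic p q r a ≠ 0 := by
  intro h
  have hd : (a.den : ℚ) ≠ 0 := by exact_mod_cast a.den_ne_zero
  have h1 : a.num ^ 3 + p * a.num ^ 2 * a.den + q * a.num * a.den ^ 2 + r * (a.den : ℤ) ^ 3
      = 0 := by
    have h2 : (a.num : ℚ) ^ 3 + p * a.num ^ 2 * a.den + q * a.num * a.den ^ 2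
        + r * (a.den : ℚ) ^ 3 = 0 := by
      rw [← Rat.num_div_den a] at h
      unfold monicCubic at h
      field_simp at h
      linear_combination h
    exact_mod_cast h2
  have h2 : Even (a.num ^ 3 + p * a.num ^ 2 * a.den + q * a.num * a.den ^ 2
      + r * (a.den : ℤ) ^ 3) := by
    rw [h1]
    exact Even.zero
  rw [← Int.not_even_iff_odd] at hr hpq
  have h3 : Even a.num ∧ Even (a.den : ℤ) := by
    simp only [Int.even_add, Int.even_mul, Int.even_pow] at h2 hpq
    tauto
  have h4 : IsCoprime a.num (a.den : ℤ) := Rat.isCoprime_num_den a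
  exact absurd (h4.isUnit_of_dvd' h3.1.two_dvd h3.2.two_dvd) (by decide)

theorem monicCubic_two_mul_cos_seven : monicCubic 1 (-2) (-1) (2 * Real.cos (2 * (π / 7))) = 0 := by
  set θ := 2 * (π / 7) with hθ
  have hπ := Real.pi_pos
  have h1 : Real.cos (2 * (2 * θ)) = Real.cos (3 * θ) := by
    rw [← Real.cos_two_pi_sub (3 * θ)]
    congr 1
    rw [hθ]
    ring
  rw [Real.cos_two_mul, Real.cos_two_mul, Real.cos_three_mul] at h1
  have h2 : Real.cos θ < 1 := by
    rw [← Real.cos_zero]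
    exact Real.cos_lt_cos_of_nonneg_of_le_pi le_rfl (by linarith) (by positivity)
  refine (mul_eq_zero.1 ?_).resolve_left (sub_ne_zero.2 h2.ne)
  unfold monicCubic
  push_cast
  linear_combination h1

theorem monicCubic_two_mul_cos_nine : monicCubic 0 (-3) 1 (2 * Real.cos (2 * (π / 9))) = 0 := by
  set θ := 2 * (π / 9) with hθ
  have h1 : Real.cos (3 * θ) = -(1 / 2) := by
    rw [← Real.cos_pi_div_three, ← Real.cos_pi_sub]
    congr 1
    rw [hθ]
    ring
  rw [Real.cos_three_mul] at h1
  unfold monicCubic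
  push_cast
  linear_combination 2 * h1

/-- For every `n ≥ 8`, with `ℓ = 7` (or `ℓ = 9` if `n = 14`), there are a transcendental
`c ∈ (0,1)`, `u > 0` and half central angles `α, β ∈ (0, π/2)` with
`ℓα + (n−ℓ)β = π`, `sin α = u`, `sin β = c·u`, and `u ∉ Qclo(ℚ(c))`; i.e., the cyclic
`n`-gon with `ℓ` sides of length `1` and `n−ℓ` sides of length `c` exists but is not
constructible from `1` and `c`. -/
theorem statement18 (n : ℕ) (hn : 8 ≤ n) :
    ∃ (c u α β : ℝ), c ∈ Set.Ioo (0 : ℝ) 1 ∧ TranscOver ⊥ c ∧ 0 < u ∧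
      α ∈ Set.Ioo 0 (π / 2) ∧ β ∈ Set.Ioo 0 (π / 2) ∧
      ((if n = 14 then 9 else 7 : ℕ) : ℝ) * α
        + ((n : ℝ) - ((if n = 14 then 9 else 7 : ℕ) : ℝ)) * β = π ∧
      Real.sin α = u ∧ Real.sin β = c * u ∧
      u ∉ Qclo (Subfield.closure {c}) := by
  by_cases h : n = 14
  · simp only [if_pos h]
    exact exists_nonconstructible_cyclic_polygon (by norm_num) (by omega)
      (monicCubic_ne_zero_of_odd (p := 0) (q := -3) (r := 1) (by decide) (by decide))
      (by exact_mod_cast monicCubic_two_mul_cos_nine)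
  · simp only [if_neg h]
    exact exists_nonconstructible_cyclic_polygon (by norm_num) (by omega)
      (monicCubic_ne_zero_of_odd (p := 1) (q := -2) (r := -1) (by decide) (by decide))
      (by exact_mod_cast monicCubic_two_mul_cos_seven)
end
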